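/- Chain Optimality (Lemma 1): Let (𝒫, ⊏, D) be a task graph, let start be a possible schedule on j machines, and let C_1, ..., C_k be any chain decomposition of (𝒫, ⊏). Then for every task P ∈ 𝒫 and every pair (s, d) ∈ start(P), the task P belongs to the set F(s) of least elements of the chains at time s; that is, P lies in C_i \ A(s) for the chain C_i containing P, and for every x ∈ C_i \ A(s) either P ⊏ x or P = x. Consequently, at any point in time every task that is scheduled to run is a least element of the uncompleted portion of its chain, so any possible schedule can be computed by considering only the least elements of the chains. -/

import Mathlib

open scoped Classical BigOperators

/-- A task graph: a finite set of tasks `P` with a strict partial order `lt`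
(dependency relation) and a duration function `D`. -/
structure TaskGraph (P : Type) [Fintype P] where
  lt : P → P → Prop
  lt_irrefl : ∀ p, ¬ lt p p
  lt_trans : ∀ p q r, lt p q → lt q r → lt p r
  D : P → ℕ

/-- The set of start times of the segments of task `p`. -/
def startTimes {P : Type} [Fintype P] (start : P → Finset (ℝ × ℝ)) (p : P) : Set ℝ :=
  {s | ∃ d : ℝ, (s, d) ∈ start p}

/-- The set of end times `s + d` of the segments of task `p`. -/
def endTimes {P : Type} [Fintype P] (start : P → Finset (ℝ × ℝ)) (p : P) : Set ℝ :=
  {x | ∃ s d : ℝ, (s, d) ∈ start p ∧ x = s + d}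

/-- `start` is a possible schedule of the task graph `G` on `j` machines.
Each task is assigned a finite set of pairs `(s, d)` (start time, segment duration). -/
structure IsSchedule {P : Type} [Fintype P] (G : TaskGraph P) (j : ℕ)
    (start : P → Finset (ℝ × ℝ)) : Prop where
  /-- Start times are nonnegative. -/
  nonneg_start : ∀ p : P, ∀ sd ∈ start p, (0 : ℝ) ≤ sd.1
  /-- Segment durations are positive. -/
  pos_dur : ∀ p : P, ∀ sd ∈ start p, (0 : ℝ) < sd.2
  /-- (1) No task runs before all of its predecessors have completed. -/
  precedence : ∀ p p' : P, G.lt p' p →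
    sSup (endTimes start p') ≤ sInf (startTimes start p)
  /-- (2) At any point in time at most `j` machines run tasks. -/
  machines : ∀ t : ℝ, 0 ≤ t →
    (Finset.univ.filter fun p : P =>
      ∃ sd ∈ start p, sd.1 ≤ t ∧ t ≤ sd.1 + sd.2).card ≤ j
  /-- (3) Running a single task in parallel is not allowed: segments of a task
  are pairwise disjoint in time. -/
  no_overlap : ∀ p : P, ∀ sd ∈ start p, ∀ sd' ∈ start p, sd ≠ sd' →
    sd.1 + sd.2 ≤ sd'.1 ∨ sd'.1 + sd'.2 ≤ sd.1
  /-- (4) The intermediate durations of a task sum up to its full duration. -/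
  total_dur : ∀ p : P, ∑ sd ∈ start p, sd.2 = (G.D p : ℝ)

/-- The set `A(t)` of tasks completed at time `t`. -/
def completed {P : Type} [Fintype P] (G : TaskGraph P)
    (start : P → Finset (ℝ × ℝ)) (t : ℝ) : Set P :=
  {p | ∑ sd ∈ (start p).filter (fun sd => sd.1 + sd.2 ≤ t), sd.2 = (G.D p : ℝ)}

/-- A task is not completed at the start time of one of its own segments. -/
theorem IsSchedule.notMem_completed {P : Type} [Fintype P] {G : TaskGraph P} {j : ℕ}
    {start : P → Finset (ℝ × ℝ)} (h : IsSchedule G j start) {p : P} {s d : ℝ}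
    (hp : (s, d) ∈ start p) : p ∉ completed G start s := by
  intro hc
  have hd : 0 < d := h.pos_dur p _ hp
  have hlt : ∑ sd ∈ (start p).filter (fun sd => sd.1 + sd.2 ≤ s), sd.2 <
      ∑ sd ∈ start p, sd.2 :=
    Finset.sum_lt_sum_of_subset (Finset.filter_subset _ _) hp
      (by simp [hd]) hd (fun sd hsd _ => (h.pos_dur p sd hsd).le)
  exact hlt.ne (Eq.trans hc (h.total_dur p).symm)

/-- Every segment of a predecessor of `p` ends before any segment of `p` starts. -/
theorem IsSchedule.end_le_start {P : Type} [Fintype P] {G : TaskGraph P} {j : ℕ}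
    {start : P → Finset (ℝ × ℝ)} (h : IsSchedule G j start) {p p' : P} (hlt : G.lt p' p)
    {s d : ℝ} (hp : (s, d) ∈ start p) {sd : ℝ × ℝ} (hsd : sd ∈ start p') :
    sd.1 + sd.2 ≤ s := by
  have hfin : (endTimes start p').Finite := by
    refine ((start p').finite_toSet.image fun sd => sd.1 + sd.2).subset ?_
    rintro _ ⟨s', d', hmem, rfl⟩
    exact ⟨(s', d'), hmem, rfl⟩
  have hbdd : BddBelow (startTimes start p) :=
    ⟨0, fun _ ⟨_, hmem⟩ => h.nonneg_start p _ hmem⟩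
  calc sd.1 + sd.2 ≤ sSup (endTimes start p') :=
        le_csSup hfin.bddAbove ⟨sd.1, sd.2, hsd, rfl⟩
    _ ≤ sInf (startTimes start p) := h.precedence p p' hlt
    _ ≤ s := csInf_le hbdd ⟨d, hp⟩

/-- All predecessors of `p` are completed when a segment of `p` starts. -/
theorem IsSchedule.mem_completed_of_lt {P : Type} [Fintype P] {G : TaskGraph P} {j : ℕ}
    {start : P → Finset (ℝ × ℝ)} (h : IsSchedule G j start) {p p' : P} (hlt : G.lt p' p)
    {s d : ℝ} (hp : (s, d) ∈ start p) : p' ∈ completed G start s := by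
  change ∑ sd ∈ (start p').filter (fun sd => sd.1 + sd.2 ≤ s), sd.2 = (G.D p' : ℝ)
  rw [Finset.filter_true_of_mem fun sd hsd => h.end_le_start hlt hp hsd, h.total_dur]

/-- **Chain Optimality (Lemma 1).** Given a task graph, a possible schedule on
`j` machines, and any chain decomposition `C 0, ..., C (k-1)` of the tasks, every
task `p` is, at any time `s` at which one of its segments is scheduled, a least
element of the uncompleted portion of the chain containing it: `p ∉ A(s)` and for
every `x` in `C i \ A(s)` (where `C i` is the chain containing `p`),
either `p ⊏ x` or `p = x`. -/
theorem chain_optimality {P : Type} [Fintype P] (G : TaskGraph P) (j : ℕ)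
    (start : P → Finset (ℝ × ℝ)) (hsched : IsSchedule G j start)
    (k : ℕ) (C : Fin k → Set P)
    (hcover : ∀ p : P, ∃ i : Fin k, p ∈ C i)
    (hdisj : ∀ i i' : Fin k, i ≠ i' → Disjoint (C i) (C i'))
    (hchain : ∀ i : Fin k, ∀ p ∈ C i, ∀ p' ∈ C i, p ≠ p' → G.lt p p' ∨ G.lt p' p) :
    ∀ p : P, ∀ s d : ℝ, (s, d) ∈ start p → ∀ i : Fin k, p ∈ C i →
      p ∈ C i \ completed G start s ∧
      ∀ x ∈ C i \ completed G start s, G.lt p x ∨ p = x := by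
  intro p s d hp i hpi
  refine ⟨⟨hpi, hsched.notMem_completed hp⟩, ?_⟩
  rintro x ⟨hxi, hxc⟩
  by_cases hpx : p = x
  · exact Or.inr hpx
  · exact Or.inl ((hchain i p hpi x hxi hpx).resolve_right
      fun hlt => hxc (hsched.mem_completed_of_lt hlt hp))
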